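/- For every commutative ring S there exists a faithfully flat S-algebra T with the following property: every countably presented faithfully flat T-algebra R admits a T-algebra homomorphism R → T (equivalently, the structure map T → R admits a T-algebra retraction). -/

import Mathlib

universe u

/-- An `S`-algebra `R` is *countably presented* if it is isomorphic (as an
`S`-algebra) to a quotient of a polynomial `S`-algebra in countably many
variables by a countably generated ideal. -/
def Algebra.IsCountablyPresented (S R : Type u) [CommRing S] [CommRing R]
    [Algebra S R] : Prop :=
  ∃ I : Ideal (MvPolynomial ℕ S),
    (∃ s : Set (MvPolynomial ℕ S), s.Countable ∧ Ideal.span s = I) ∧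
      Nonempty (R ≃ₐ[S] (MvPolynomial ℕ S ⧸ I))

universe v w

open CategoryTheory Limits

namespace CategoryTheory

section
variable {C : Type v} [Category.{w} C] {D : Type*} [Category* D]

lemma MorphismProperty.IsStableUnderFilteredColimits.inverseImage (W : MorphismProperty D)
    (F : C ⥤ D) [MorphismProperty.IsStableUnderFilteredColimits.{u, u} W]
    [PreservesFilteredColimitsOfSize.{u, u} F] :
    MorphismProperty.IsStableUnderFilteredColimits.{u, u} (W.inverseImage F) where
  isStableUnderColimitsOfShape J _ _ :=
    { condition X₁ X₂ c₁ c₂ h₁ h₂ f hf φ hφ :=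
        MorphismProperty.IsStableUnderColimitsOfShape.condition (W := W) (X₁ ⋙ F) (X₂ ⋙ F) _ _
          (isColimitOfPreserves F h₁) (isColimitOfPreserves F h₂)
          (Functor.whiskerRight f F) (fun j ↦ hf j) (F.map φ)
          (fun j ↦ by simp [← Functor.map_comp, hφ]) }

end

section
variable {C : Type v} [Category.{w} C] [HasPushouts C] (W : MorphismProperty C)

open Classical in
/-- Adjoin to `X` one of the morphisms `f i` that does not yet map to `X` under `A`. -/
noncomputable def adjoinSuccStruct {A : C} {ι : Type u} {R : ι → C} (f : ∀ i, A ⟶ R i) :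
    SmallObject.SuccStruct (Under A) where
  X₀ := Under.mk (𝟙 A)
  succ X := if h : ∃ i, IsEmpty (Under.mk (f i) ⟶ X) then
    Under.mk (X.hom ≫ pushout.inl X.hom (f h.choose)) else X
  toSucc X := if h : ∃ i, IsEmpty (Under.mk (f i) ⟶ X) then
    (Under.homMk (pushout.inl X.hom (f h.choose)) :
      X ⟶ Under.mk (X.hom ≫ pushout.inl X.hom (f h.choose))) ≫ eqToHom (by rw [dif_pos h])
    else eqToHom (by rw [dif_neg h])

variable {A : C} {ι : Type u} {R : ι → C} (f : ∀ i, A ⟶ R i)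

lemma adjoinSuccStruct_prop_le [W.IsMultiplicative] [W.IsStableUnderCobaseChange]
    (hf : ∀ i, W (f i)) :
    (adjoinSuccStruct f).prop ≤ W.inverseImage (Under.forget A) := by
  rintro _ _ _ ⟨X⟩
  dsimp only [adjoinSuccStruct]
  split_ifs with h
  · rw [(W.inverseImage (Under.forget A)).cancel_right_of_respectsIso]
    exact MorphismProperty.pushout_inl _ (f h.choose) (hf h.choose)
  · exact (W.inverseImage (Under.forget A)).of_isIso _

lemma exists_isEmpty_and_nonempty_of_adjoinSuccStruct_prop {X Y : Under A} {g : X ⟶ Y}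
    (hg : (adjoinSuccStruct f).prop g) (h : ∃ i, IsEmpty (Under.mk (f i) ⟶ X)) :
    ∃ i, IsEmpty (Under.mk (f i) ⟶ X) ∧ Nonempty (Under.mk (f i) ⟶ Y) := by
  refine ⟨h.choose, h.choose_spec, ⟨?_⟩⟩
  let Z : Under A := Under.mk (X.hom ≫ pushout.inl X.hom (f h.choose))
  have e : Y = Z := hg.succ_eq.symm.trans (dif_pos h)
  exact (Under.homMk (pushout.inr X.hom (f h.choose)) pushout.condition.symm : _ ⟶ Z) ≫
    eqToHom e.symm

/-- A class of morphisms stable under cobase change and filtered colimits contains a morphism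
factoring through each member of a given small family in the class. -/
lemma exists_forall_factors [HasColimitsOfSize.{u, u} C] [W.IsMultiplicative]
    [W.IsStableUnderCobaseChange]
    [MorphismProperty.IsStableUnderFilteredColimits.{u, u} W] (hf : ∀ i, W (f i)) :
    ∃ (B : C) (g : A ⟶ B), W g ∧ ∀ i, ∃ h : R i ⟶ B, f i ≫ h = g := by
  have : MorphismProperty.IsStableUnderFilteredColimits.{u, u}
    (W.inverseImage (Under.forget A)) := .inverseImage W _
  let κ : Cardinal.{u} := Order.succ (max Cardinal.aleph0 (Cardinal.mk ι))
  have hκ : Cardinal.aleph0 ≤ κ := (le_max_left _ _).trans (Order.le_succ _)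
  have := Cardinal.noMaxOrder hκ
  have : Nonempty κ.ord.ToType := by
    rw [← Cardinal.mk_ne_zero_iff, Cardinal.mk_ord_toType]
    exact (Cardinal.aleph0_pos.trans_le hκ).ne'
  let : OrderBot κ.ord.ToType := WellFoundedLT.toOrderBot _
  let Φ := adjoinSuccStruct f
  let c := (Φ.transfiniteCompositionOfShapeιIteration κ.ord.ToType)
  refine ⟨_, (Φ.iteration κ.ord.ToType).hom, ?_, ?_⟩
  · have h : W (Φ.ιIteration κ.ord.ToType).right :=
      (W.inverseImage (Under.forget A)).transfiniteCompositionsOfShape_le _ _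
        (c.ofLE (adjoinSuccStruct_prop_le W f hf)).mem
    rw [← Under.w (Φ.ιIteration κ.ord.ToType)]
    exact W.comp_mem _ _ (W.id_mem A) h
  · suffices ∀ i, Nonempty (Under.mk (f i) ⟶ Φ.iteration κ.ord.ToType) from fun i ↦
      ⟨(this i).some.right, Under.w (this i).some⟩
    by_contra! h
    obtain ⟨i₀, hi₀⟩ := h
    have h₀ (j) : ∃ i, IsEmpty (Under.mk (f i) ⟶ c.F.obj j) :=
      ⟨i₀, ⟨fun a ↦ hi₀.elim (a ≫ c.incl.app j)⟩⟩
    choose i hi hi' using fun j ↦ exists_isEmpty_and_nonempty_of_adjoinSuccStruct_prop f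
      (c.map_mem j (not_isMax j)) (h₀ j)
    have hinj : Function.Injective i := by
      refine .of_lt_imp_ne fun j k hjk e ↦ (hi k).elim ?_
      rw [← e]
      exact (hi' j).some ≫ c.F.map (homOfLE (Order.succ_le_of_lt hjk))
    have := Cardinal.mk_le_of_injective hinj
    rw [Cardinal.mk_ord_toType] at this
    exact (this.trans (le_max_right _ _)).not_gt (Order.lt_succ _)
end
end CategoryTheory

namespace CommRingCat

/-- The class of faithfully flat ring homomorphisms. -/
def faithfullyFlat : MorphismProperty CommRingCat.{u} :=
  RingHom.toMorphismProperty RingHom.FaithfullyFlat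

instance : faithfullyFlat.{u}.IsMultiplicative where
  id_mem _ := RingHom.FaithfullyFlat.of_bijective Function.bijective_id
  comp_mem _ _ hf hg := RingHom.FaithfullyFlat.stableUnderComposition _ _ hf hg

instance : faithfullyFlat.{u}.IsStableUnderCobaseChange :=
  RingHom.isStableUnderCobaseChange_toMorphismProperty_iff.mpr
    RingHom.FaithfullyFlat.isStableUnderBaseChange

section
variable {J : Type u} [SmallCategory J] {F : J ⥤ CommRingCat.{u}}

lemma exists_rep_of_isCardinalFiltered {κ : Cardinal.{u}} [Fact κ.IsRegular]
    [IsCardinalFiltered J κ] {c : Cocone F} (hc : IsColimit c) {ι : Type v} (hι : HasCardinalLT ι κ)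
    (x : ι → c.pt) : ∃ (j : J) (y : ι → F.obj j), ∀ i, c.ι.app j (y i) = x i := by
  have := isFiltered_of_isCardinalFiltered J κ
  choose j y hy using fun i ↦ Concrete.isColimit_exists_rep F hc (x i)
  refine ⟨IsCardinalFiltered.max j hι, fun i ↦ F.map (IsCardinalFiltered.toMax j hι i) (y i),
    fun i ↦ ?_⟩
  rw [← CommRingCat.comp_apply, c.w]
  exact hy i

variable [IsFiltered J]

lemma exists_rep_of_finite {c : Cocone F} (hc : IsColimit c) {ι : Type v} [Finite ι]
    (x : ι → c.pt) : ∃ (j : J) (y : ι → F.obj j), ∀ i, c.ι.app j (y i) = x i :=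
  have : Fact Cardinal.aleph0.{u}.IsRegular := ⟨Cardinal.isRegular_aleph0⟩
  have : IsCardinalFiltered J Cardinal.aleph0.{u} :=
    (isCardinalFiltered_aleph0_iff J).mpr ‹_›
  exists_rep_of_isCardinalFiltered hc (hasCardinalLT_aleph0_iff ι |>.mpr ‹_›) x

lemma exists_map_eq {c : Cocone F} (hc : IsColimit c) {j : J} {x y : F.obj j}
    (h : c.ι.app j x = c.ι.app j y) : ∃ (k : J) (g : j ⟶ k), F.map g x = F.map g y :=
  by
  obtain ⟨k, g₁, g₂, h⟩ := Concrete.isColimit_exists_of_rep_eq F hc x y h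
  refine ⟨IsFiltered.coeq g₁ g₂, g₁ ≫ IsFiltered.coeqHom g₁ g₂, ?_⟩
  conv_rhs => rw [IsFiltered.coeq_condition]
  simp [h]

lemma flat_of_isColimit {X₁ X₂ : J ⥤ CommRingCat.{u}} {c₁ : Cocone X₁} {c₂ : Cocone X₂}
    (h₁ : IsColimit c₁) (h₂ : IsColimit c₂) (f : X₁ ⟶ X₂) (hf : ∀ j, (f.app j).hom.Flat)
    (φ : c₁.pt ⟶ c₂.pt) (hφ : ∀ j, c₁.ι.app j ≫ φ = f.app j ≫ c₂.ι.app j) : φ.hom.Flat := by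
  algebraize [φ.hom]
  refine Module.Flat.of_forall_isTrivialRelation fun {l a x} h ↦ ?_
  have hφ' (j) (x : X₁.obj j) : φ (c₁.ι.app j x) = c₂.ι.app j (f.app j x) :=
    ConcreteCategory.congr_hom (hφ j) x
  have hw₁ {j k} (g : j ⟶ k) (x : X₁.obj j) : c₁.ι.app k (X₁.map g x) = c₁.ι.app j x :=
    ConcreteCategory.congr_hom (c₁.w g) x
  have hw₂ {j k} (g : j ⟶ k) (x : X₂.obj j) : c₂.ι.app k (X₂.map g x) = c₂.ι.app j x :=
    ConcreteCategory.congr_hom (c₂.w g) x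
  have hnat {j k} (g : j ⟶ k) (x : X₁.obj j) : f.app k (X₁.map g x) = X₂.map g (f.app j x) :=
    ConcreteCategory.congr_hom (f.naturality g) x
  obtain ⟨j₁, a', ha'⟩ := exists_rep_of_finite h₁ a
  obtain ⟨j₂, x', hx'⟩ := exists_rep_of_finite h₂ x
  let g₁ := IsFiltered.leftToMax j₁ j₂
  let g₂ := IsFiltered.rightToMax j₁ j₂
  obtain ⟨k, g, hg⟩ := exists_map_eq h₂ (j := IsFiltered.max j₁ j₂)
    (x := ∑ i, f.app _ (X₁.map g₁ (a' i)) * X₂.map g₂ (x' i)) (y := 0) (by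
      simp only [map_sum, map_mul, map_zero, hw₂, ← hφ', hw₁, ha', hx']
      exact h)
  algebraize [(f.app k).hom]
  have : Module.Flat (X₁.obj k) (X₂.obj k) := hf k
  obtain ⟨n, b, y, hb, hy⟩ := Module.Flat.isTrivialRelation_of_sum_smul_eq_zero
    (R := X₁.obj k) (M := X₂.obj k)
    (f := fun i ↦ X₁.map g (X₁.map g₁ (a' i))) (x := fun i ↦ X₂.map g (X₂.map g₂ (x' i))) (by
      simp only [map_sum, map_mul, map_zero, ← hnat] at hg
      exact hg)
  refine ⟨n, fun i m ↦ c₁.ι.app k (b i m), fun m ↦ c₂.ι.app k (y m), fun i ↦ ?_, fun m ↦ ?_⟩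
  · have := congr_arg (c₂.ι.app k) (hb i)
    simp only [hw₂, hx', map_sum, Algebra.smul_def, map_mul] at this
    simp only [this, Algebra.smul_def]
    exact Finset.sum_congr rfl fun m _ ↦ congr_arg (· * _) (hφ' _ _).symm
  · have := congr_arg (c₁.ι.app k) (hy m)
    simpa only [map_sum, map_mul, hw₁, ha', map_zero] using this

lemma faithfullyFlat_of_isColimit {X₁ X₂ : J ⥤ CommRingCat.{u}} {c₁ : Cocone X₁} {c₂ : Cocone X₂}
    (h₁ : IsColimit c₁) (h₂ : IsColimit c₂) (f : X₁ ⟶ X₂) (hf : ∀ j, (f.app j).hom.FaithfullyFlat)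
    (φ : c₁.pt ⟶ c₂.pt) (hφ : ∀ j, c₁.ι.app j ≫ φ = f.app j ≫ c₂.ι.app j) :
    φ.hom.FaithfullyFlat := by
  have hφ' (j) (x : X₁.obj j) : φ (c₁.ι.app j x) = c₂.ι.app j (f.app j x) :=
    ConcreteCategory.congr_hom (hφ j) x
  have hw₁ {j k} (g : j ⟶ k) (x : X₁.obj j) : c₁.ι.app k (X₁.map g x) = c₁.ι.app j x :=
    ConcreteCategory.congr_hom (c₁.w g) x
  have hw₂ {j k} (g : j ⟶ k) (x : X₂.obj j) : c₂.ι.app k (X₂.map g x) = c₂.ι.app j x :=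
    ConcreteCategory.congr_hom (c₂.w g) x
  have hnat {j k} (g : j ⟶ k) (x : X₁.obj j) : f.app k (X₁.map g x) = X₂.map g (f.app j x) :=
    ConcreteCategory.congr_hom (f.naturality g) x
  have hflat := flat_of_isColimit h₁ h₂ f (fun j ↦ (hf j).flat) φ hφ
  algebraize [φ.hom]
  refine { toFlat := hflat, submodule_ne_top := fun m hm h ↦ ?_ }
  rw [Ideal.smul_top_eq_map, Submodule.restrictScalars_eq_top_iff] at h
  let N (j) : Ideal (X₂.obj j) := (m.comap (c₁.ι.app j).hom).map (f.app j).hom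
  have hN {j k} (g : j ⟶ k) : N j ≤ (N k).comap (X₂.map g).hom := by
    refine Ideal.map_le_iff_le_comap.mpr fun x hx ↦ ?_
    have hx' : X₁.map g x ∈ m.comap (c₁.ι.app k).hom := by
      simpa [Ideal.mem_comap, hw₁] using hx
    have := Ideal.mem_map_of_mem (f.app k).hom hx'
    rwa [hnat] at this
  have key : ∀ b ∈ m.map φ.hom, ∃ j, ∃ y ∈ N j, c₂.ι.app j y = b := by
    intro b hb
    induction hb using Submodule.span_induction with
    | zero => exact ⟨IsFiltered.nonempty.some, 0, zero_mem _, map_zero _⟩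
    | mem b hb =>
      obtain ⟨a, ha, rfl⟩ := hb
      obtain ⟨j, x, rfl⟩ := Concrete.isColimit_exists_rep X₁ h₁ a
      exact ⟨j, f.app j x, Ideal.mem_map_of_mem _ ha, (hφ' j x).symm⟩
    | add x y _ _ hx hy =>
      obtain ⟨j, x', hx', rfl⟩ := hx
      obtain ⟨k, y', hy', rfl⟩ := hy
      exact ⟨IsFiltered.max j k, X₂.map (IsFiltered.leftToMax j k) x' +
        X₂.map (IsFiltered.rightToMax j k) y', add_mem (hN _ hx') (hN _ hy'), by simp [hw₂]⟩
    | smul a x _ hx =>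
      obtain ⟨j, x', hx', rfl⟩ := hx
      obtain ⟨k, a', rfl⟩ := Concrete.isColimit_exists_rep X₂ h₂ a
      exact ⟨IsFiltered.max j k, X₂.map (IsFiltered.rightToMax j k) a' *
        X₂.map (IsFiltered.leftToMax j k) x', Ideal.mul_mem_left _ _ (hN _ hx'), by simp [hw₂]⟩
  obtain ⟨j, y, hy, hy'⟩ := key 1 (by rw [show m.map φ.hom = ⊤ from h]; trivial)
  obtain ⟨k, g, hg⟩ := exists_map_eq h₂ (y := 1) (hy'.trans (map_one (c₂.ι.app j).hom).symm)
  have h1 : (1 : X₂.obj k) ∈ N k := by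
    have := hN g hy
    rwa [Ideal.mem_comap, hg, map_one] at this
  algebraize [(f.app k).hom]
  have : Module.FaithfullyFlat (X₁.obj k) (X₂.obj k) := hf k
  have h2 := Ideal.comap_map_eq_self_of_faithfullyFlat (B := X₂.obj k)
    (m.comap (c₁.ι.app k).hom)
  have h3 : (N k).comap (f.app k).hom = ⊤ := by rw [(Ideal.eq_top_iff_one _).mpr h1]; rfl
  have h4 : m.comap (c₁.ι.app k).hom = ⊤ := h2.symm.trans h3
  exact hm.ne_top ((Ideal.comap_eq_top_iff).mp h4)

instance : MorphismProperty.IsStableUnderFilteredColimits.{u, u} faithfullyFlat.{u} where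
  isStableUnderColimitsOfShape _ _ _ :=
    { condition _ _ _ _ h₁ h₂ f hf φ hφ := faithfullyFlat_of_isColimit h₁ h₂ f hf φ hφ }

end
end CommRingCat

section
open TensorProduct

/-- Faithful flatness of algebras descends along faithfully flat ring maps. -/
lemma Module.FaithfullyFlat.of_faithfullyFlat_tensorProduct (A B C : Type*) [CommRing A]
    [CommRing B] [CommRing C] [Algebra A B] [Algebra A C] [Module.FaithfullyFlat A B]
    [Module.FaithfullyFlat B (B ⊗[A] C)] : Module.FaithfullyFlat A C := by
  have := Module.Flat.of_flat_tensorProduct A C B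
  have : Module.FaithfullyFlat A (B ⊗[A] C) := .trans A B _
  refine .of_comap_surjective
    (.of_comp (g := PrimeSpectrum.comap
      (Algebra.TensorProduct.includeRight : C →ₐ[A] B ⊗[A] C).toRingHom) ?_)
  rw [← PrimeSpectrum.comap_comp, AlgHom.toRingHom_eq_coe, AlgHom.comp_algebraMap]
  exact PrimeSpectrum.comap_surjective_of_faithfullyFlat

/-- The base change of the algebra presented by a family of polynomials is presented by the
base changed family. -/
noncomputable def MvPolynomial.tensorQuotientSpanEquiv (A B : Type*) [CommRing A] [CommRing B]
    [Algebra A B] {σ : Type*} (s : Set (MvPolynomial σ A)) :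
    B ⊗[A] (MvPolynomial σ A ⧸ Ideal.span s) ≃ₐ[B]
      MvPolynomial σ B ⧸ Ideal.span (map (algebraMap A B) '' s) :=
  (Algebra.TensorProduct.tensorQuotientEquiv B _ B (Ideal.span s)).trans <|
    Ideal.quotientEquivAlg _ _ (algebraTensorAlgEquiv A B) <| by
      rw [Ideal.map_span, Ideal.map_span, Set.image_image]
      simp [algebraTensorAlgEquiv_tmul]

/-- A countably presented algebra is presented by a sequence of polynomials. -/
lemma Algebra.IsCountablyPresented.exists_sequence {S R : Type u} [CommRing S] [CommRing R]
    [Algebra S R] (h : Algebra.IsCountablyPresented S R) :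
    ∃ s : ℕ → MvPolynomial ℕ S,
      Nonempty (R ≃ₐ[S] MvPolynomial ℕ S ⧸ Ideal.span (Set.range s)) := by
  obtain ⟨_, ⟨s, hs, rfl⟩, h⟩ := h
  obtain ⟨t, ht⟩ := (hs.insert 0).exists_eq_range (Set.insert_nonempty _ _)
  exact ⟨t, by rwa [← ht, Ideal.span_insert_zero]⟩
end

namespace CommRingCat

/-- A morphism `g : A ⟶ B` solves countable systems if every sequence of polynomials over `A`
presenting a faithfully flat `A`-algebra has a common zero in `B`. -/
def solvesCountableSystems : MorphismProperty CommRingCat.{u} := fun A B g ↦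
  ∀ s : ℕ → MvPolynomial ℕ A,
    Module.FaithfullyFlat A (MvPolynomial ℕ A ⧸ Ideal.span (Set.range s)) →
      ∃ x : ℕ → B, ∀ n, (s n).eval₂ g.hom x = 0

lemma exists_faithfullyFlat_solvesCountableSystems (A : CommRingCat.{u}) :
    ∃ (B : CommRingCat.{u}) (g : A ⟶ B), faithfullyFlat g ∧ solvesCountableSystems g := by
  let ι := {s : ℕ → MvPolynomial ℕ A //
    Module.FaithfullyFlat A (MvPolynomial ℕ A ⧸ Ideal.span (Set.range s))}
  let R (s : ι) : CommRingCat.{u} := of (MvPolynomial ℕ A ⧸ Ideal.span (Set.range s.1))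
  let f (s : ι) : A ⟶ R s := ofHom (algebraMap _ _)
  obtain ⟨B, g, hg, h⟩ := exists_forall_factors faithfullyFlat f fun s ↦
    RingHom.faithfullyFlat_algebraMap_iff.mpr s.property
  refine ⟨B, g, hg, fun s hs ↦ ?_⟩
  obtain ⟨k, rfl⟩ := h ⟨s, hs⟩
  refine ⟨fun i ↦ k (Ideal.Quotient.mk _ (MvPolynomial.X i)), fun n ↦ ?_⟩
  have : MvPolynomial.eval₂Hom (f ⟨s, hs⟩ ≫ k).hom
      (fun i ↦ k (Ideal.Quotient.mk _ (MvPolynomial.X i))) =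
      k.hom.comp (Ideal.Quotient.mk (Ideal.span (Set.range s))) := by
    ext a
    · simp [f]; rfl
    · simp
  refine (RingHom.congr_fun this (s n)).trans ?_
  simp [Ideal.Quotient.eq_zero_iff_mem.mpr (Ideal.subset_span (Set.mem_range_self n))]

/-- The transfinite construction that repeatedly adjoins solutions of countable systems. -/
noncomputable def solveSuccStruct (S : CommRingCat.{u}) :
    SmallObject.SuccStruct CommRingCat.{u} where
  X₀ := S
  succ A := (exists_faithfullyFlat_solvesCountableSystems A).choose
  toSucc A := (exists_faithfullyFlat_solvesCountableSystems A).choose_spec.choose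

lemma solveSuccStruct_prop_le (S : CommRingCat.{u}) :
    (solveSuccStruct S).prop ≤ faithfullyFlat ⊓ solvesCountableSystems := by
  rintro _ _ _ ⟨A⟩
  exact (exists_faithfullyFlat_solvesCountableSystems _).choose_spec.choose_spec

/-- A small family of polynomials over a colimit comes from a stage of the colimit. -/
lemma exists_map_mvPolynomial_eq {J : Type u} [SmallCategory J] {F : J ⥤ CommRingCat.{u}}
    {κ : Cardinal.{u}} [Fact κ.IsRegular] [IsCardinalFiltered J κ] {c : Cocone F}
    (hc : IsColimit c) {ι σ : Type*} (h : HasCardinalLT (ι × (σ →₀ ℕ)) κ)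
    (s : ι → MvPolynomial σ c.pt) : ∃ (j : J) (t : ι → MvPolynomial σ (F.obj j)),
      ∀ i, (t i).map (c.ι.app j).hom = s i := by
  obtain ⟨j, y, hy⟩ := exists_rep_of_isCardinalFiltered hc h fun p ↦ (s p.1).coeff p.2
  refine ⟨j, fun i ↦ ∑ m ∈ (s i).support, MvPolynomial.monomial m (y (i, m)), fun i ↦ ?_⟩
  conv_rhs => rw [← (s i).support_sum_monomial_coeff]
  rw [map_sum]
  exact Finset.sum_congr rfl fun m _ ↦ by
    rw [MvPolynomial.map_monomial]
    exact congr_arg (MvPolynomial.monomial m) (hy (i, m))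

lemma exists_faithfullyFlat_solvesCountableSystems_id (S : CommRingCat.{u}) :
    ∃ (T : CommRingCat.{u}) (g : S ⟶ T), faithfullyFlat g ∧ solvesCountableSystems (𝟙 T) := by
  let κ : Cardinal.{u} := Cardinal.aleph 1
  have : Fact κ.IsRegular := ⟨Cardinal.isRegular_aleph_one⟩
  have hκ : Cardinal.aleph0 ≤ κ := Cardinal.aleph0_le_aleph 1
  have := Cardinal.noMaxOrder hκ
  have := isFiltered_of_isCardinalFiltered κ.ord.ToType κ
  have : Nonempty κ.ord.ToType := IsFiltered.nonempty
  let : OrderBot κ.ord.ToType := WellFoundedLT.toOrderBot _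
  let Φ := solveSuccStruct S
  let c := Φ.transfiniteCompositionOfShapeιIteration κ.ord.ToType
  let c' := c.ofLE ((solveSuccStruct_prop_le S).trans inf_le_left)
  refine ⟨_, Φ.ιIteration κ.ord.ToType, faithfullyFlat.transfiniteCompositionsOfShape_le _ _ c'.mem,
    fun s hs ↦ ?_⟩
  have hcount : HasCardinalLT (ℕ × (ℕ →₀ ℕ)) κ := by
    simp [HasCardinalLT, κ]
  obtain ⟨j, t, ht⟩ := exists_map_mvPolynomial_eq c.isColimit hcount s
  let T := Φ.iteration κ.ord.ToType
  let : Algebra (c.F.obj j) T := (c.incl.app j).hom.toAlgebra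
  have hj : Module.FaithfullyFlat (c.F.obj j) T := c'.mem_incl_app j
  have hs' : MvPolynomial.map (algebraMap (c.F.obj j) T) '' Set.range t = Set.range s := by
    rw [← Set.range_comp]
    exact congr_arg Set.range (funext ht)
  have : Module.FaithfullyFlat T (TensorProduct (c.F.obj j) T
      (MvPolynomial ℕ (c.F.obj j) ⧸ Ideal.span (Set.range t))) := by
    rw [← hs'] at hs
    exact .of_linearEquiv _ _ (MvPolynomial.tensorQuotientSpanEquiv _ T _).toLinearEquiv
  obtain ⟨x, hx⟩ := (solveSuccStruct_prop_le S _ (c.map_mem j (not_isMax j))).2 t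
    (.of_faithfullyFlat_tensorProduct _ T _)
  refine ⟨fun n ↦ c.incl.app (Order.succ j) (x n), fun n ↦ ?_⟩
  have hw : (c.incl.app j).hom = (c.incl.app (Order.succ j)).hom.comp
      (c.F.map (homOfLE (Order.le_succ j))).hom := by
    rw [← CommRingCat.hom_comp]
    exact congr_arg Hom.hom (c.incl.naturality (homOfLE (Order.le_succ j))).symm
  have := congr_arg (c.incl.app (Order.succ j)).hom (hx n)
  rw [map_zero, MvPolynomial.hom_eval₂, ← hw] at this
  rw [← ht n, MvPolynomial.eval₂_map]
  exact this

end CommRingCat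

/-- For every commutative ring `S` there is a faithfully flat `S`-algebra `T`
such that every countably presented faithfully flat `T`-algebra `R` admits a
`T`-algebra homomorphism `R → T`. -/
theorem exists_faithfullyFlat_splitting_countably_presented_covers
    (S : Type u) [CommRing S] :
    ∃ (T : Type u) (_ : CommRing T) (_ : Algebra S T),
      Module.FaithfullyFlat S T ∧
        ∀ (R : Type u) (_ : CommRing R) (_ : Algebra T R),
          Algebra.IsCountablyPresented T R →
          Module.FaithfullyFlat T R →
          Nonempty (R →ₐ[T] T) := by
  obtain ⟨T, g, hg, hT⟩ := CommRingCat.exists_faithfullyFlat_solvesCountableSystems_id (.of S)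
  refine ⟨T, inferInstance, g.hom.toAlgebra, hg, fun R _ _ hR _ ↦ ?_⟩
  obtain ⟨s, ⟨e⟩⟩ := hR.exists_sequence
  obtain ⟨x, hx⟩ := hT s (.of_linearEquiv _ _ e.symm.toLinearEquiv)
  refine ⟨.comp (Ideal.Quotient.liftₐ _ (MvPolynomial.aeval x) fun p hp ↦ ?_) e.toAlgHom⟩
  exact (Ideal.span_le (I := RingHom.ker (MvPolynomial.aeval x).toRingHom)).mpr
    (by rintro _ ⟨n, rfl⟩; exact hx n) hp
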